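/- arXiv:2509.01029 — 3 statements merged into one kernel-verified Lean document; each statement's English description precedes it below -/
import Mathlib

section
/- Let ℱ be a construction scheme. Then ℱ is 2-capturing if and only if for every uncountable set S ⊆ ω₁ there are infinitely many l ∈ ω for which some pair {α, β} of distinct elements of S is captured at level l (i.e., ⟨{α},{β}⟩ is captured at level l). -/
noncomputable section

open scoped Classical

/-- The first uncountable ordinal. -/
def omegaOne : Ordinal := (Cardinal.aleph 1).ord

/-- A scheme type. -/
structure SchemeType where
  m : ℕ → ℕ
  n : ℕ → ℕ
  r : ℕ → ℕ
  m_zero : m 0 = 1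
  n_ge : ∀ k, 2 ≤ n (k + 1)
  r_lt : ∀ k, r (k + 1) < m k
  m_succ : ∀ k, m (k + 1) = r (k + 1) + (m k - r (k + 1)) * n (k + 1)

/-- `A` is an initial segment of `B`. -/
def InitSeg (A B : Finset Ordinal) : Prop := ∀ a ∈ A, ∀ b ∈ B, b < a → b ∈ A

/-- `D`, `R` form the canonical decomposition of `F ∈ ℱ_{k+1}`. -/
def IsDecomposition (T : SchemeType) (ℱ : Set (Finset Ordinal)) (k : ℕ)
    (F : Finset Ordinal) (D : ℕ → Finset Ordinal) (R : Finset Ordinal) : Prop :=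
  (∀ i < T.n (k + 1), D i ∈ ℱ ∧ (D i).card = T.m k) ∧
  F = (Finset.range (T.n (k + 1))).biUnion D ∧
  R.card = T.r (k + 1) ∧
  (∀ i < T.n (k + 1), ∀ j < T.n (k + 1), i ≠ j → D i ∩ D j = R) ∧
  (∀ i < T.n (k + 1), ∀ x ∈ R, ∀ y ∈ D i \ R, x < y) ∧
  (∀ i j, i < j → j < T.n (k + 1) → ∀ x ∈ D i \ R, ∀ y ∈ D j \ R, x < y)

/-- `ℱ` is a construction scheme of type `T` on `ω₁`. -/
structure IsConstructionScheme (T : SchemeType) (ℱ : Set (Finset Ordinal)) : Prop where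
  nonempty_mem : ∀ F ∈ ℱ, F.Nonempty
  mem_subset : ∀ F ∈ ℱ, ↑F ⊆ Set.Iio omegaOne
  cofinal : ∀ A : Finset Ordinal, ↑A ⊆ Set.Iio omegaOne → ∃ F ∈ ℱ, A ⊆ F
  card_eq : ∀ F ∈ ℱ, ∃ k, F.card = T.m k
  inter_initSeg : ∀ k : ℕ, ∀ E ∈ ℱ, ∀ F ∈ ℱ, E.card = T.m k → F.card = T.m k →
    InitSeg (E ∩ F) E ∧ InitSeg (E ∩ F) F
  decomp : ∀ k : ℕ, ∀ F ∈ ℱ, F.card = T.m (k + 1) → ∃ D R, IsDecomposition T ℱ k F D R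

/-- `ρ(α,β)`: least `k` such that `{α,β}` is included in a member of `ℱ_k`. -/
def rho (T : SchemeType) (ℱ : Set (Finset Ordinal)) (α β : Ordinal) : ℕ :=
  sInf {k | ∃ F ∈ ℱ, F.card = T.m k ∧ α ∈ F ∧ β ∈ F}

/-- `‖α‖_k`, the cardinality of `(α)_k \ {α}`. -/
def nrm (T : SchemeType) (ℱ : Set (Finset Ordinal)) (α : Ordinal) (k : ℕ) : ℕ :=
  Set.ncard {ξ : Ordinal | ξ < α ∧ rho T ℱ α ξ ≤ k}

/-- `Δ(α,β)`: least `k` with `‖α‖_k ≠ ‖β‖_k`. -/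
def deltaOrd (T : SchemeType) (ℱ : Set (Finset Ordinal)) (α β : Ordinal) : ℕ :=
  sInf {k | nrm T ℱ α k ≠ nrm T ℱ β k}

/-- `Ξ_α(k)`. -/
def Xi (T : SchemeType) (ℱ : Set (Finset Ordinal)) (α : Ordinal) (k : ℕ) : ℤ :=
  if k = 0 then 0
  else if h : ∃ i : ℕ, ∃ F ∈ ℱ, ∃ D R, F.card = T.m k ∧ α ∈ F ∧
      IsDecomposition T ℱ (k - 1) F D R ∧ i < T.n k ∧ α ∈ D i ∧ α ∉ R
  then (h.choose : ℤ) else -1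

/-- The `a`-th element of a finite set of ordinals, in increasing order. -/
def elt (A : Finset Ordinal) (a : ℕ) : Ordinal := (A.sort (· ≤ ·)).getD a 0

/-- The family `⟨D_0, …, D_{j-1}⟩` is Δ-captured at level `l`. -/
def DeltaCapturedFam (T : SchemeType) (ℱ : Set (Finset Ordinal)) (j : ℕ)
    (D : ℕ → Finset Ordinal) (l : ℕ) : Prop :=
  ∃ R : Finset Ordinal,
    (∀ i < j, ∀ i' < j, (D i).card = (D i').card) ∧
    (∀ i < j, ∀ i' < j, i ≠ i' → D i ∩ D i' = R) ∧
    (∀ i < j, ∀ x ∈ R, ∀ y ∈ D i \ R, x < y) ∧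
    (∀ i i', i < i' → i' < j → ∀ x ∈ D i \ R, ∀ y ∈ D i' \ R, x < y) ∧
    (∀ i < j, ∀ a < R.card, Xi T ℱ (elt (D i) a) l = -1) ∧
    (∀ i < j, ∀ a, R.card ≤ a → a < (D i).card → Xi T ℱ (elt (D i) a) l = (i : ℤ)) ∧
    (∀ i < j, ∀ i' < j, i ≠ i' → ∀ a, R.card ≤ a → a < (D i).card →
      deltaOrd T ℱ (elt (D i) a) (elt (D i') a) = l)

/-- The family `⟨D_0, …, D_{j-1}⟩` is captured at level `l`. -/
def CapturedFam (T : SchemeType) (ℱ : Set (Finset Ordinal)) (j : ℕ)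
    (D : ℕ → Finset Ordinal) (l : ℕ) : Prop :=
  DeltaCapturedFam T ℱ j D l ∧
  ∀ i < j, ∀ i' < j, i ≠ i' → ∀ a, (D i ∩ D i').card ≤ a → a < (D i).card →
    rho T ℱ (elt (D i) a) (elt (D i') a) = l

/-- The ordered pair `⟨A, B⟩`, as a family. -/
def pairFam (A B : Finset Ordinal) : ℕ → Finset Ordinal := fun i => if i = 0 then A else B

/-- A pair of ordinals `α < β` is captured at level `l`, i.e. `⟨{α},{β}⟩` is. -/
def CapturedPair (T : SchemeType) (ℱ : Set (Finset Ordinal)) (α β : Ordinal) (l : ℕ) : Prop :=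
  α < β ∧ Xi T ℱ α l = 0 ∧ Xi T ℱ β l = 1 ∧ deltaOrd T ℱ α β = l ∧ rho T ℱ α β = l

/-- `ℱ` is a 2-Δ-capturing scheme. -/
def TwoDeltaCapturing (T : SchemeType) (ℱ : Set (Finset Ordinal)) : Prop :=
  ∀ 𝒮 : Set (Finset Ordinal), (∀ A ∈ 𝒮, A.Nonempty ∧ ↑A ⊆ Set.Iio omegaOne) →
    ¬ 𝒮.Countable →
    {l : ℕ | ∃ A ∈ 𝒮, ∃ B ∈ 𝒮, A ≠ B ∧ DeltaCapturedFam T ℱ 2 (pairFam A B) l}.Infinite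

/-- `ℱ` is a 2-capturing scheme. -/
def TwoCapturing (T : SchemeType) (ℱ : Set (Finset Ordinal)) : Prop :=
  ∀ 𝒮 : Set (Finset Ordinal), (∀ A ∈ 𝒮, A.Nonempty ∧ ↑A ⊆ Set.Iio omegaOne) →
    ¬ 𝒮.Countable →
    {l : ℕ | ∃ A ∈ 𝒮, ∃ B ∈ 𝒮, A ≠ B ∧ CapturedFam T ℱ 2 (pairFam A B) l}.Infinite

/-- `ℱ` is a fully Δ-capturing scheme. -/
def FullyDeltaCapturing (T : SchemeType) (ℱ : Set (Finset Ordinal)) : Prop :=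
  ∀ 𝒮 : Set (Finset Ordinal), (∀ A ∈ 𝒮, A.Nonempty ∧ ↑A ⊆ Set.Iio omegaOne) →
    ¬ 𝒮.Countable →
    {l : ℕ | ∃ D : ℕ → Finset Ordinal, (∀ i < T.n l, D i ∈ 𝒮) ∧
      (∀ i < T.n l, ∀ i' < T.n l, i ≠ i' → D i ≠ D i') ∧
      DeltaCapturedFam T ℱ (T.n l) D l}.Infinite

/-- `E` is an `n`-entangled subset of the linear order `X`. -/
def IsNEntangled {X : Type*} [LinearOrder X] (E : Set X) (n : ℕ) : Prop :=
  ¬ E.Countable ∧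
  ∀ τ : Fin n → Fin 2, ∀ 𝒜 : Set (Fin n → X),
    (∀ a ∈ 𝒜, StrictMono a ∧ ∀ i, a i ∈ E) →
    (𝒜.Pairwise fun a b => ∀ i j, a i ≠ b j) →
    ¬ 𝒜.Countable →
    ∃ a ∈ 𝒜, ∃ b ∈ 𝒜, a ≠ b ∧ ∀ i, (a i < b i ↔ τ i = 0)


/-- The members of `ℱ` of cardinality `m_k`. -/
def schemeLevel (T : SchemeType) (ℱ : Set (Finset Ordinal)) (k : ℕ) : Set (Finset Ordinal) :=
  {F | F ∈ ℱ ∧ F.card = T.m k}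

section Elt

lemma elt_eq_orderEmbOfFin (A : Finset Ordinal) {a : ℕ} (ha : a < A.card) :
    elt A a = A.orderEmbOfFin rfl ⟨a, ha⟩ := by
  rw [Finset.orderEmbOfFin_apply, elt,
    List.getD_eq_getElem _ _ (by rw [Finset.length_sort]; exact ha)]
  rfl

lemma elt_mem {A : Finset Ordinal} {a : ℕ} (ha : a < A.card) : elt A a ∈ A := by
  rw [elt_eq_orderEmbOfFin A ha]
  exact Finset.orderEmbOfFin_mem _ _ _

lemma elt_lt_elt {A : Finset Ordinal} {a b : ℕ} (hab : a < b) (hb : b < A.card) :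
    elt A a < elt A b := by
  rw [elt_eq_orderEmbOfFin A hb, elt_eq_orderEmbOfFin A (hab.trans hb)]
  exact (A.orderEmbOfFin rfl).strictMono hab

lemma exists_elt_eq {A : Finset Ordinal} {x : Ordinal} (hx : x ∈ A) :
    ∃ a < A.card, elt A a = x := by
  have h : x ∈ Set.range (A.orderEmbOfFin rfl) := by
    rw [Finset.range_orderEmbOfFin]; exact hx
  obtain ⟨i, hi⟩ := h
  exact ⟨i, i.2, by rw [elt_eq_orderEmbOfFin A i.2]; exact hi⟩

lemma elt_singleton (x : Ordinal) : elt {x} 0 = x := by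
  simp [elt]

lemma elt_mem_iff_of_initSeg {A R : Finset Ordinal} (hRA : R ⊆ A) (hR : InitSeg R A) {a : ℕ}
    (ha : a < A.card) : elt A a ∈ R ↔ a < R.card := by
  have hinj : Set.InjOn (elt A) (Finset.range A.card : Finset ℕ) := by
    intro b hb c hc h
    simp only [Finset.coe_range, Set.mem_Iio] at hb hc
    rcases lt_trichotomy b c with hlt | rfl | hlt
    · exact absurd h (elt_lt_elt hlt hc).ne
    · rfl
    · exact absurd h (elt_lt_elt hlt hb).ne'
  set I : Finset ℕ := (Finset.range A.card).filter (fun b => elt A b ∈ R) with hI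
  have hIR : I.image (elt A) = R := by
    ext x
    simp only [hI, Finset.mem_image, Finset.mem_filter, Finset.mem_range]
    constructor
    · rintro ⟨b, ⟨-, hb⟩, rfl⟩
      exact hb
    · intro hx
      obtain ⟨b, hb, rfl⟩ := exists_elt_eq (hRA hx)
      exact ⟨b, ⟨hb, hx⟩, rfl⟩
  have hcard : I.card = R.card := by
    rw [← hIR, Finset.card_image_of_injOn]
    exact hinj.mono (by simp [hI, Set.subset_def]; tauto)
  constructor
  · intro h
    have hsub : Finset.range (a + 1) ⊆ I := by
      intro b hb
      rw [Finset.mem_range, Nat.lt_succ_iff] at hb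
      rw [hI, Finset.mem_filter, Finset.mem_range]
      refine ⟨hb.trans_lt ha, ?_⟩
      rcases hb.eq_or_lt with rfl | hb
      · exact h
      · exact hR _ h _ (elt_mem (hb.trans ha)) (elt_lt_elt hb ha)
    have := Finset.card_le_card hsub
    rw [Finset.card_range] at this
    omega
  · intro h
    by_contra hn
    have hsub : I ⊆ Finset.range a := by
      intro b hb
      rw [hI, Finset.mem_filter, Finset.mem_range] at hb
      rw [Finset.mem_range]
      by_contra hba
      rcases (not_lt.mp hba).eq_or_lt with rfl | hlt
      · exact hn hb.2
      · exact hn (hR _ hb.2 _ (elt_mem ha) (elt_lt_elt hlt hb.1))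
    have := Finset.card_le_card hsub
    rw [Finset.card_range] at this
    omega

lemma apply_elt_eq_of_image_eq {A B : Finset Ordinal} {f : Ordinal → ℕ}
    (hA : StrictMonoOn f A) (hB : StrictMonoOn f B) (h : A.image f = B.image f) {a : ℕ}
    (ha : a < A.card) (hb : a < B.card) : f (elt A a) = f (elt B a) := by
  have key : ∀ C : Finset Ordinal, StrictMonoOn f C → C.image f = A.image f →
      ∀ hc : a < C.card, ∃ h : a < (A.image f).card,
        f (elt C a) = (A.image f).orderEmbOfFin rfl ⟨a, h⟩ := by
    intro C hC hCA hc
    have hcard : (A.image f).card = C.card := by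
      rw [← hCA, Finset.card_image_of_injOn hC.injOn]
    refine ⟨hcard ▸ hc, ?_⟩
    have huniq := Finset.orderEmbOfFin_unique (s := A.image f) (k := C.card) hcard
      (f := fun i => f (C.orderEmbOfFin rfl i))
      (fun i => hCA ▸ Finset.mem_image_of_mem f (Finset.orderEmbOfFin_mem _ _ _))
      (fun i j hij => hC (Finset.orderEmbOfFin_mem _ _ _) (Finset.orderEmbOfFin_mem _ _ _)
        ((C.orderEmbOfFin rfl).strictMono hij))
    rw [elt_eq_orderEmbOfFin C hc]
    have := congrFun huniq ⟨a, hc⟩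
    rw [Finset.orderEmbOfFin_apply] at this ⊢
    exact this
  obtain ⟨_, h1⟩ := key A hA rfl ha
  obtain ⟨_, h2⟩ := key B hB h.symm hb
  rw [h1, h2]

end Elt

section Decomposition

variable {T : SchemeType} {ℱ : Set (Finset Ordinal)} {k : ℕ} {F : Finset Ordinal}
  {D : ℕ → Finset Ordinal} {R : Finset Ordinal}

namespace IsDecomposition

lemma mem_level (h : IsDecomposition T ℱ k F D R) {i : ℕ} (hi : i < T.n (k + 1)) :
    D i ∈ schemeLevel T ℱ k :=
  h.1 i hi

lemma mem_iff (h : IsDecomposition T ℱ k F D R) {x : Ordinal} :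
    x ∈ F ↔ ∃ i < T.n (k + 1), x ∈ D i := by
  rw [h.2.1]; simp

lemma subset (h : IsDecomposition T ℱ k F D R) {i : ℕ} (hi : i < T.n (k + 1)) : D i ⊆ F :=
  fun _ hx => h.mem_iff.2 ⟨i, hi, hx⟩

lemma root_subset (h : IsDecomposition T ℱ k F D R) {i : ℕ} (hi : i < T.n (k + 1)) :
    R ⊆ D i := by
  have hn := T.n_ge k
  obtain ⟨j, hj, hij⟩ : ∃ j < T.n (k + 1), i ≠ j := by
    rcases Nat.eq_zero_or_pos i with rfl | hi0
    · exact ⟨1, by omega, by omega⟩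
    · exact ⟨0, by omega, by omega⟩
  rw [← h.2.2.2.1 i hi j hj hij]
  exact Finset.inter_subset_left

lemma mem_root (h : IsDecomposition T ℱ k F D R) {i j : ℕ} (hi : i < T.n (k + 1))
    (hj : j < T.n (k + 1)) (hij : i ≠ j) {x : Ordinal} (hxi : x ∈ D i) (hxj : x ∈ D j) :
    x ∈ R := by
  rw [← h.2.2.2.1 i hi j hj hij]
  exact Finset.mem_inter.2 ⟨hxi, hxj⟩

lemma root_lt (h : IsDecomposition T ℱ k F D R) {i : ℕ} (hi : i < T.n (k + 1))
    {x y : Ordinal} (hx : x ∈ R) (hy : y ∈ D i) (hyR : y ∉ R) : x < y :=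
  h.2.2.2.2.1 i hi x hx y (Finset.mem_sdiff.2 ⟨hy, hyR⟩)

lemma lt (h : IsDecomposition T ℱ k F D R) {i j : ℕ} (hij : i < j) (hj : j < T.n (k + 1))
    {x y : Ordinal} (hx : x ∈ D i) (hxR : x ∉ R) (hy : y ∈ D j) (hyR : y ∉ R) : x < y :=
  h.2.2.2.2.2 i j hij hj x (Finset.mem_sdiff.2 ⟨hx, hxR⟩) y (Finset.mem_sdiff.2 ⟨hy, hyR⟩)

lemma filter_lt_of_mem_root (h : IsDecomposition T ℱ k F D R) {i : ℕ} (hi : i < T.n (k + 1))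
    {x : Ordinal} (hx : x ∈ R) : F.filter (· < x) = (D i).filter (· < x) := by
  ext y
  simp only [Finset.mem_filter, and_congr_left_iff]
  intro hyx
  refine ⟨fun hy => ?_, fun hy => h.subset hi hy⟩
  obtain ⟨j, hj, hyj⟩ := h.mem_iff.1 hy
  by_cases hyR : y ∈ R
  · exact h.root_subset hi hyR
  · exact absurd hyx (h.root_lt hj hx hyj hyR).not_gt

lemma card_filter_lt_of_mem_root (h : IsDecomposition T ℱ k F D R) {x : Ordinal} (hx : x ∈ R) :
    (F.filter (· < x)).card < T.r (k + 1) := by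
  rw [← h.2.2.1]
  refine Finset.card_lt_card ⟨fun y hy => ?_, fun hsub => ?_⟩
  · rw [Finset.mem_filter] at hy
    obtain ⟨j, hj, hyj⟩ := h.mem_iff.1 hy.1
    by_contra hyR
    exact absurd hy.2 (h.root_lt hj hx hyj hyR).not_gt
  · exact lt_irrefl x (Finset.mem_filter.1 (hsub hx)).2

lemma le_card_filter_lt (h : IsDecomposition T ℱ k F D R) {i : ℕ} (hi : i < T.n (k + 1))
    {x : Ordinal} (hx : x ∈ D i) (hxR : x ∉ R) :
    T.r (k + 1) ≤ ((D i).filter (· < x)).card := by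
  rw [← h.2.2.1]
  exact Finset.card_le_card fun y hy =>
    Finset.mem_filter.2 ⟨h.root_subset hi hy, h.root_lt hi hy hx hxR⟩

lemma card_filter_lt (h : IsDecomposition T ℱ k F D R) {i : ℕ} (hi : i < T.n (k + 1))
    {x : Ordinal} (hx : x ∈ D i) (hxR : x ∉ R) :
    (F.filter (· < x)).card =
      ((D i).filter (· < x)).card + (T.m k - T.r (k + 1)) * i := by
  have hunion : F.filter (· < x) =
      (D i).filter (· < x) ∪ (Finset.range i).biUnion (fun j => D j \ R) := by
    ext y
    simp only [Finset.mem_union, Finset.mem_filter, Finset.mem_biUnion, Finset.mem_range,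
      Finset.mem_sdiff]
    constructor
    · rintro ⟨hy, hyx⟩
      obtain ⟨j, hj, hyj⟩ := h.mem_iff.1 hy
      by_cases hyR : y ∈ R
      · exact Or.inl ⟨h.root_subset hi hyR, hyx⟩
      · rcases lt_trichotomy j i with hji | rfl | hij
        · exact Or.inr ⟨j, hji, hyj, hyR⟩
        · exact Or.inl ⟨hyj, hyx⟩
        · exact absurd hyx (h.lt hij hj hx hxR hyj hyR).not_gt
    · rintro (⟨hy, hyx⟩ | ⟨j, hji, hyj, hyR⟩)
      · exact ⟨h.subset hi hy, hyx⟩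
      · exact ⟨h.subset (hji.trans hi) hyj, h.lt hji hi hyj hyR hx hxR⟩
  rw [hunion, Finset.card_union_of_disjoint, Finset.card_biUnion]
  · have hsum : ∀ j ∈ Finset.range i, (D j \ R).card = T.m k - T.r (k + 1) := by
      intro j hj
      have hj' := (Finset.mem_range.1 hj).trans hi
      rw [Finset.card_sdiff_of_subset (h.root_subset hj'), (h.mem_level hj').2, h.2.2.1]
    rw [Finset.sum_congr rfl hsum, Finset.sum_const, Finset.card_range, smul_eq_mul, mul_comm]
  · intro j hj j' hj' hne
    simp only [Function.onFun, Finset.disjoint_left]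
    intro y hy hy'
    rw [Finset.mem_sdiff] at hy hy'
    exact hy.2 (h.mem_root ((Finset.mem_range.1 hj).trans hi) ((Finset.mem_range.1 hj').trans hi)
      hne hy.1 hy'.1)
  · rw [Finset.disjoint_left]
    intro y hy hy'
    simp only [Finset.mem_biUnion, Finset.mem_range, Finset.mem_sdiff] at hy'
    obtain ⟨j, hj, hyj, hyR⟩ := hy'
    exact hyR (h.mem_root (hj.trans hi) hi hj.ne hyj (Finset.mem_filter.1 hy).1)

end IsDecomposition

end Decomposition

lemma rho_comm (T : SchemeType) (ℱ : Set (Finset Ordinal)) (α β : Ordinal) :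
    rho T ℱ α β = rho T ℱ β α := by
  simp only [rho, and_comm (a := α ∈ _)]

lemma deltaOrd_comm (T : SchemeType) (ℱ : Set (Finset Ordinal)) (α β : Ordinal) :
    deltaOrd T ℱ α β = deltaOrd T ℱ β α := by
  simp only [deltaOrd, ne_comm]

section Scheme

variable {T : SchemeType} {ℱ : Set (Finset Ordinal)}

lemma rho_le {k : ℕ} {F : Finset Ordinal} (hF : F ∈ schemeLevel T ℱ k) {x y : Ordinal}
    (hx : x ∈ F) (hy : y ∈ F) : rho T ℱ x y ≤ k :=
  Nat.sInf_le ⟨F, hF.1, hF.2, hx, hy⟩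

namespace IsConstructionScheme

lemma exists_decomposition (hS : IsConstructionScheme T ℱ) {k : ℕ} {F : Finset Ordinal}
    (hF : F ∈ schemeLevel T ℱ (k + 1)) : ∃ D R, IsDecomposition T ℱ k F D R :=
  hS.decomp k F hF.1 hF.2

lemma exists_mem_level_subset (hS : IsConstructionScheme T ℱ) {j k : ℕ} (hjk : j ≤ k)
    {F : Finset Ordinal} (hF : F ∈ schemeLevel T ℱ k) {x : Ordinal} (hx : x ∈ F) :
    ∃ E ∈ schemeLevel T ℱ j, x ∈ E ∧ E ⊆ F := by
  induction k, hjk using Nat.le_induction generalizing F with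
  | base => exact ⟨F, hF, hx, subset_rfl⟩
  | succ k _ ih =>
    obtain ⟨D, R, hD⟩ := hS.exists_decomposition hF
    obtain ⟨i, hi, hxi⟩ := hD.mem_iff.1 hx
    obtain ⟨E, hE, hxE, hEi⟩ := ih (hD.mem_level hi) hxi
    exact ⟨E, hE, hxE, hEi.trans (hD.subset hi)⟩

lemma mem_of_le (hS : IsConstructionScheme T ℱ) {j k : ℕ} (hjk : j ≤ k)
    {E F : Finset Ordinal} (hE : E ∈ schemeLevel T ℱ j) (hF : F ∈ schemeLevel T ℱ k)
    {x y : Ordinal} (hyE : y ∈ E) (hyF : y ∈ F) (hxy : x ≤ y) (hx : x ∈ E) : x ∈ F := by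
  obtain ⟨E', hE', hyE', hE'F⟩ := hS.exists_mem_level_subset hjk hF hyF
  rcases hxy.eq_or_lt with rfl | hlt
  · exact hyF
  · have := (hS.inter_initSeg j E hE.1 E' hE'.1 hE.2 hE'.2).1 y
      (Finset.mem_inter.2 ⟨hyE, hyE'⟩) x hx hlt
    exact hE'F (Finset.mem_inter.1 this).2

lemma exists_mem_level_rho (hS : IsConstructionScheme T ℱ) {x y : Ordinal}
    (hx : x < omegaOne) (hy : y < omegaOne) :
    ∃ E ∈ schemeLevel T ℱ (rho T ℱ x y), x ∈ E ∧ y ∈ E := by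
  have hne : {k | ∃ F ∈ ℱ, F.card = T.m k ∧ x ∈ F ∧ y ∈ F}.Nonempty := by
    obtain ⟨F, hF, hsub⟩ := hS.cofinal {x, y} (by
      intro z hz
      simp only [Finset.coe_insert, Finset.coe_singleton, Set.mem_insert_iff,
        Set.mem_singleton_iff] at hz
      rcases hz with rfl | rfl
      · exact hx
      · exact hy)
    obtain ⟨k, hk⟩ := hS.card_eq F hF
    exact ⟨k, F, hF, hk, hsub (by simp), hsub (by simp)⟩
  obtain ⟨E, hE, hc, hxE, hyE⟩ := Nat.sInf_mem hne
  exact ⟨E, ⟨hE, hc⟩, hxE, hyE⟩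

lemma mem_of_rho_le (hS : IsConstructionScheme T ℱ) {k : ℕ} {F : Finset Ordinal}
    (hF : F ∈ schemeLevel T ℱ k) {x y : Ordinal} (hy : y ∈ F) (hxy : x < y)
    (h : rho T ℱ y x ≤ k) : x ∈ F := by
  have hy1 : y < omegaOne := hS.mem_subset F hF.1 hy
  obtain ⟨E, hE, hyE, hxE⟩ := hS.exists_mem_level_rho hy1 (hxy.trans hy1)
  exact hS.mem_of_le h hE hF hyE hy hxy.le hxE

lemma nrm_eq (hS : IsConstructionScheme T ℱ) {k : ℕ} {F : Finset Ordinal}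
    (hF : F ∈ schemeLevel T ℱ k) {x : Ordinal} (hx : x ∈ F) :
    nrm T ℱ x k = (F.filter (· < x)).card := by
  rw [nrm, ← Set.ncard_coe_finset]
  congr 1
  ext y
  simp only [Set.mem_ofPred_eq, Finset.coe_filter]
  exact ⟨fun h => ⟨hS.mem_of_rho_le hF hx h.1 h.2, h.1⟩,
    fun h => ⟨h.2, rho_le hF hx h.1⟩⟩

lemma nrm_strictMonoOn (hS : IsConstructionScheme T ℱ) {k : ℕ} {F : Finset Ordinal}
    (hF : F ∈ schemeLevel T ℱ k) : StrictMonoOn (fun x => nrm T ℱ x k) F := by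
  intro x hx y hy hxy
  simp only
  rw [hS.nrm_eq hF hx, hS.nrm_eq hF hy]
  refine Finset.card_lt_card ⟨fun z hz => ?_, fun hsub => ?_⟩
  · rw [Finset.mem_filter] at hz ⊢
    exact ⟨hz.1, hz.2.trans hxy⟩
  · exact lt_irrefl x (Finset.mem_filter.1 (hsub (Finset.mem_filter.2 ⟨hx, hxy⟩))).2

lemma nrm_injOn (hS : IsConstructionScheme T ℱ) {k : ℕ} {F : Finset Ordinal}
    (hF : F ∈ schemeLevel T ℱ k) {x y : Ordinal} (hx : x ∈ F) (hy : y ∈ F)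
    (h : nrm T ℱ x k = nrm T ℱ y k) : x = y :=
  (hS.nrm_strictMonoOn hF).injOn hx hy h

lemma nrm_lt (hS : IsConstructionScheme T ℱ) {k : ℕ} {F : Finset Ordinal}
    (hF : F ∈ schemeLevel T ℱ k) {x : Ordinal} (hx : x ∈ F) : nrm T ℱ x k < T.m k := by
  rw [hS.nrm_eq hF hx, ← hF.2]
  exact Finset.card_lt_card ⟨Finset.filter_subset _ _,
    fun hsub => lt_irrefl x (Finset.mem_filter.1 (hsub hx)).2⟩

lemma exists_mem_nrm_eq (hS : IsConstructionScheme T ℱ) {k : ℕ} {F : Finset Ordinal}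
    (hF : F ∈ schemeLevel T ℱ k) {p : ℕ} (hp : p < T.m k) : ∃ x ∈ F, nrm T ℱ x k = p := by
  have himage : F.image (fun x => nrm T ℱ x k) = Finset.range (T.m k) := by
    refine Finset.eq_of_subset_of_card_le (fun q hq => ?_) ?_
    · obtain ⟨x, hx, rfl⟩ := Finset.mem_image.1 hq
      exact Finset.mem_range.2 (hS.nrm_lt hF hx)
    · rw [Finset.card_image_of_injOn (hS.nrm_strictMonoOn hF).injOn, Finset.card_range, hF.2]
  have : p ∈ F.image (fun x => nrm T ℱ x k) := himage ▸ Finset.mem_range.2 hp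
  simpa using this

section Pieces

variable {k : ℕ} {F : Finset Ordinal} {D : ℕ → Finset Ordinal} {R : Finset Ordinal}

lemma nrm_succ_of_mem_root (hS : IsConstructionScheme T ℱ) (hF : F ∈ schemeLevel T ℱ (k + 1))
    (hD : IsDecomposition T ℱ k F D R) {x : Ordinal} (hx : x ∈ R) :
    nrm T ℱ x (k + 1) = nrm T ℱ x k ∧ nrm T ℱ x (k + 1) < T.r (k + 1) := by
  have h0 : 0 < T.n (k + 1) := by have := T.n_ge k; omega
  have hx0 := hD.root_subset h0 hx
  rw [hS.nrm_eq hF (hD.subset h0 hx0), hS.nrm_eq (hD.mem_level h0) hx0]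
  exact ⟨by rw [hD.filter_lt_of_mem_root h0 hx], hD.card_filter_lt_of_mem_root hx⟩

lemma nrm_succ_of_notMem_root (hS : IsConstructionScheme T ℱ)
    (hF : F ∈ schemeLevel T ℱ (k + 1)) (hD : IsDecomposition T ℱ k F D R) {i : ℕ}
    (hi : i < T.n (k + 1)) {x : Ordinal} (hx : x ∈ D i) (hxR : x ∉ R) :
    nrm T ℱ x (k + 1) = nrm T ℱ x k + (T.m k - T.r (k + 1)) * i ∧
      T.r (k + 1) ≤ nrm T ℱ x k := by
  rw [hS.nrm_eq hF (hD.subset hi hx), hS.nrm_eq (hD.mem_level hi) hx]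
  exact ⟨hD.card_filter_lt hi hx hxR, hD.le_card_filter_lt hi hx hxR⟩

variable {F' : Finset Ordinal} {D' : ℕ → Finset Ordinal} {R' : Finset Ordinal}

lemma mem_root_of_nrm_eq (hS : IsConstructionScheme T ℱ) (hF : F ∈ schemeLevel T ℱ (k + 1))
    (hF' : F' ∈ schemeLevel T ℱ (k + 1)) (hD : IsDecomposition T ℱ k F D R)
    (hD' : IsDecomposition T ℱ k F' D' R') {x x' : Ordinal} (hx : x ∈ R) (hx' : x' ∈ F')
    (h : nrm T ℱ x (k + 1) = nrm T ℱ x' (k + 1)) : x' ∈ R' := by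
  by_contra hn
  obtain ⟨j, hj, hxj⟩ := hD'.mem_iff.1 hx'
  have h1 := hS.nrm_succ_of_mem_root hF hD hx
  have h2 := hS.nrm_succ_of_notMem_root hF' hD' hj hxj hn
  omega

lemma index_eq_of_nrm_eq (hS : IsConstructionScheme T ℱ) (hF : F ∈ schemeLevel T ℱ (k + 1))
    (hF' : F' ∈ schemeLevel T ℱ (k + 1)) (hD : IsDecomposition T ℱ k F D R)
    (hD' : IsDecomposition T ℱ k F' D' R') {x x' : Ordinal} {i j : ℕ} (hi : i < T.n (k + 1))
    (hj : j < T.n (k + 1)) (hx : x ∈ D i) (hxR : x ∉ R) (hx' : x' ∈ D' j) (hxR' : x' ∉ R')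
    (h : nrm T ℱ x (k + 1) = nrm T ℱ x' (k + 1)) : i = j := by
  have h1 := hS.nrm_succ_of_notMem_root hF hD hi hx hxR
  have h2 := hS.nrm_succ_of_notMem_root hF' hD' hj hx' hxR'
  have b1 := hS.nrm_lt (hD.mem_level hi) hx
  have b2 := hS.nrm_lt (hD'.mem_level hj) hx'
  have hr := T.r_lt k
  obtain ⟨d, hd⟩ : ∃ d, T.m k = T.r (k + 1) + d := ⟨T.m k - T.r (k + 1), by omega⟩
  have hd' : T.m k - T.r (k + 1) = d := by omega
  rw [hd'] at h1 h2
  rcases lt_trichotomy i j with hlt | heq | hlt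
  · have := Nat.mul_le_mul_left d (Nat.succ_le_of_lt hlt)
    rw [Nat.mul_succ] at this
    omega
  · exact heq
  · have := Nat.mul_le_mul_left d (Nat.succ_le_of_lt hlt)
    rw [Nat.mul_succ] at this
    omega

lemma mem_piece_of_nrm_eq (hS : IsConstructionScheme T ℱ) (hF : F ∈ schemeLevel T ℱ (k + 1))
    (hF' : F' ∈ schemeLevel T ℱ (k + 1)) (hD : IsDecomposition T ℱ k F D R)
    (hD' : IsDecomposition T ℱ k F' D' R') {x x' : Ordinal} {i : ℕ} (hi : i < T.n (k + 1))
    (hx : x ∈ D i) (hx' : x' ∈ F') (h : nrm T ℱ x (k + 1) = nrm T ℱ x' (k + 1)) :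
    x' ∈ D' i ∧ nrm T ℱ x k = nrm T ℱ x' k := by
  by_cases hxR : x ∈ R
  · have hxR' := hS.mem_root_of_nrm_eq hF hF' hD hD' hxR hx' h
    have h1 := hS.nrm_succ_of_mem_root hF hD hxR
    have h2 := hS.nrm_succ_of_mem_root hF' hD' hxR'
    exact ⟨hD'.root_subset hi hxR', by omega⟩
  · have hxR' : x' ∉ R' := fun hxR' =>
      hxR (hS.mem_root_of_nrm_eq hF' hF hD' hD hxR' (hD.subset hi hx) h.symm)
    obtain ⟨j, hj, hxj⟩ := hD'.mem_iff.1 hx'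
    obtain rfl := hS.index_eq_of_nrm_eq hF hF' hD hD' hi hj hx hxR hxj hxR' h
    have h1 := hS.nrm_succ_of_notMem_root hF hD hi hx hxR
    have h2 := hS.nrm_succ_of_notMem_root hF' hD' hj hxj hxR'
    exact ⟨hxj, by omega⟩

lemma Xi_eq_of_mem_root (hS : IsConstructionScheme T ℱ) (hF : F ∈ schemeLevel T ℱ (k + 1))
    (hD : IsDecomposition T ℱ k F D R) {x : Ordinal} (hx : x ∈ R) :
    Xi T ℱ x (k + 1) = -1 := by
  rw [Xi, if_neg (Nat.succ_ne_zero k), dif_neg]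
  rintro ⟨i, F', hF', D', R', hc, hxF', hD', -, -, hxR'⟩
  exact hxR' (hS.mem_root_of_nrm_eq hF ⟨hF', hc⟩ hD hD' hx hxF' rfl)

lemma Xi_eq_of_notMem_root (hS : IsConstructionScheme T ℱ)
    (hF : F ∈ schemeLevel T ℱ (k + 1)) (hD : IsDecomposition T ℱ k F D R) {i : ℕ}
    (hi : i < T.n (k + 1)) {x : Ordinal} (hx : x ∈ D i) (hxR : x ∉ R) :
    Xi T ℱ x (k + 1) = i := by
  have hex : ∃ i : ℕ, ∃ F ∈ ℱ, ∃ D R, F.card = T.m (k + 1) ∧ x ∈ F ∧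
      IsDecomposition T ℱ (k + 1 - 1) F D R ∧ i < T.n (k + 1) ∧ x ∈ D i ∧ x ∉ R :=
    ⟨i, F, hF.1, D, R, hF.2, hD.subset hi hx, hD, hi, hx, hxR⟩
  rw [Xi, if_neg (Nat.succ_ne_zero k), dif_pos hex]
  obtain ⟨F', hF', D', R', hc, -, hD', hj, hxj, hxR'⟩ := hex.choose_spec
  rw [hS.index_eq_of_nrm_eq hF ⟨hF', hc⟩ hD hD' hi hj hx hxR hxj hxR' rfl]

lemma mem_piece_of_Xi_eq (hS : IsConstructionScheme T ℱ) (hF : F ∈ schemeLevel T ℱ (k + 1))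
    (hD : IsDecomposition T ℱ k F D R) {i : ℕ} {x : Ordinal} (hx : x ∈ F)
    (h : Xi T ℱ x (k + 1) = i) : x ∈ D i ∧ x ∉ R := by
  have hxR : x ∉ R := fun hxR => by
    rw [hS.Xi_eq_of_mem_root hF hD hxR] at h
    omega
  obtain ⟨j, hj, hxj⟩ := hD.mem_iff.1 hx
  rw [hS.Xi_eq_of_notMem_root hF hD hj hxj hxR] at h
  obtain rfl : j = i := by exact_mod_cast h
  exact ⟨hxj, hxR⟩

end Pieces

lemma nrm_eq_of_le (hS : IsConstructionScheme T ℱ) {j k : ℕ} (hjk : j ≤ k)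
    {F F' : Finset Ordinal} (hF : F ∈ schemeLevel T ℱ k) (hF' : F' ∈ schemeLevel T ℱ k)
    {x x' : Ordinal} (hx : x ∈ F) (hx' : x' ∈ F') (h : nrm T ℱ x k = nrm T ℱ x' k) :
    nrm T ℱ x j = nrm T ℱ x' j := by
  induction k, hjk using Nat.le_induction generalizing F F' with
  | base => exact h
  | succ k _ ih =>
    obtain ⟨D, R, hD⟩ := hS.exists_decomposition hF
    obtain ⟨D', R', hD'⟩ := hS.exists_decomposition hF'
    obtain ⟨i, hi, hxi⟩ := hD.mem_iff.1 hx
    obtain ⟨hxi', heq⟩ := hS.mem_piece_of_nrm_eq hF hF' hD hD' hi hxi hx' h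
    exact ih (hD.mem_level hi) (hD'.mem_level hi) hxi hxi' heq

/-- The increasing bijection between two members of the same level preserves `ρ ≤ k`. -/
lemma exists_mem_level_of_nrm_eq (hS : IsConstructionScheme T ℱ) {k l : ℕ} (hkl : k ≤ l)
    {G G' E : Finset Ordinal} (hG : G ∈ schemeLevel T ℱ l) (hG' : G' ∈ schemeLevel T ℱ l)
    (hE : E ∈ schemeLevel T ℱ k) {x y x' y' : Ordinal} (hx : x ∈ G) (hy : y ∈ G)
    (hx' : x' ∈ G') (hy' : y' ∈ G') (hxx' : nrm T ℱ x l = nrm T ℱ x' l)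
    (hyy' : nrm T ℱ y l = nrm T ℱ y' l) (hxy : x ≤ y) (hxE : x ∈ E) (hyE : y ∈ E) :
    ∃ E' ∈ schemeLevel T ℱ k, x' ∈ E' ∧ y' ∈ E' := by
  induction l, hkl using Nat.le_induction generalizing G G' with
  | base => exact ⟨G', hG', hx', hy'⟩
  | succ l hkl ih =>
    obtain ⟨D, R, hD⟩ := hS.exists_decomposition hG
    obtain ⟨D', R', hD'⟩ := hS.exists_decomposition hG'
    obtain ⟨i, hi, hyi⟩ := hD.mem_iff.1 hy
    have hxi := hS.mem_of_le hkl hE (hD.mem_level hi) hyE hyi hxy hxE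
    obtain ⟨hyi', hy_eq⟩ := hS.mem_piece_of_nrm_eq hG hG' hD hD' hi hyi hy' hyy'
    obtain ⟨hxi', hx_eq⟩ := hS.mem_piece_of_nrm_eq hG hG' hD hD' hi hxi hx' hxx'
    exact ih (hD.mem_level hi) (hD'.mem_level hi) hxi hyi hxi' hyi' hx_eq hy_eq

lemma deltaOrd_eq (hS : IsConstructionScheme T ℱ) {l : ℕ} {G G₀ G₁ : Finset Ordinal}
    (hG : G ∈ schemeLevel T ℱ (l + 1)) (hG₀ : G₀ ∈ schemeLevel T ℱ l)
    (hG₁ : G₁ ∈ schemeLevel T ℱ l) {x y : Ordinal} (hx : x ∈ G₀) (hy : y ∈ G₁) (hxG : x ∈ G)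
    (hyG : y ∈ G) (hxy : x ≠ y) (h : nrm T ℱ x l = nrm T ℱ y l) :
    deltaOrd T ℱ x y = l + 1 := by
  have hmem : l + 1 ∈ {k | nrm T ℱ x k ≠ nrm T ℱ y k} :=
    fun heq => hxy (hS.nrm_injOn hG hxG hyG heq)
  refine le_antisymm (Nat.sInf_le hmem) ?_
  by_contra hlt
  exact Nat.sInf_mem ⟨_, hmem⟩
    (hS.nrm_eq_of_le (Nat.lt_succ_iff.1 (not_le.1 hlt)) hG₀ hG₁ hx hy h)

lemma rho_eq (hS : IsConstructionScheme T ℱ) {l : ℕ} {G : Finset Ordinal}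
    {D : ℕ → Finset Ordinal} {R : Finset Ordinal} (hG : G ∈ schemeLevel T ℱ (l + 1))
    (hD : IsDecomposition T ℱ l G D R) {i j : ℕ} (hij : i < j) (hj : j < T.n (l + 1))
    {x y : Ordinal} (hx : x ∈ D i) (hxR : x ∉ R) (hy : y ∈ D j) (hyR : y ∉ R) :
    rho T ℱ x y = l + 1 := by
  refine le_antisymm
    (rho_le hG (hD.subset (hij.trans hj) hx) (hD.subset hj hy)) ?_
  by_contra hlt
  rw [rho_comm] at hlt
  have hxj := hS.mem_of_rho_le (hD.mem_level hj) hy (hD.lt hij hj hx hxR hy hyR)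
    (Nat.lt_succ_iff.1 (not_le.1 hlt))
  exact hxR (hD.mem_root (hij.trans hj) hj hij.ne hx hxj)

/-- Lifting captured pairs: if the maxima of two sets that sit in the same position inside members
of level `k` are captured at a level `l > k`, then so are the sets. -/
lemma capturedFam_of_capturedPair (hS : IsConstructionScheme T ℱ) {k l : ℕ} (hkl : k < l)
    {A B F F' : Finset Ordinal} (hF : F ∈ schemeLevel T ℱ k) (hF' : F' ∈ schemeLevel T ℱ k)
    (hAF : A ⊆ F) (hBF' : B ⊆ F')
    (himage : A.image (fun x => nrm T ℱ x k) = B.image (fun x => nrm T ℱ x k))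
    {α β : Ordinal} (hα : α ∈ A) (hαmax : ∀ x ∈ A, x ≤ α) (hβ : β ∈ B) (hβmax : ∀ x ∈ B, x ≤ β)
    (hcap : CapturedPair T ℱ α β l) : CapturedFam T ℱ 2 (pairFam A B) l := by
  obtain ⟨l, rfl⟩ : ∃ l', l = l' + 1 := ⟨l - 1, by omega⟩
  obtain ⟨-, hXα, hXβ, hΔ, hρ⟩ := hcap
  have hkl' : k ≤ l := Nat.lt_succ_iff.1 hkl
  have hn := T.n_ge l
  have h0 : 0 < T.n (l + 1) := by omega
  have h1 : 1 < T.n (l + 1) := by omega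
  obtain ⟨G, hG, hαG, hβG⟩ := hS.exists_mem_level_rho (hS.mem_subset F hF.1 (hAF hα))
    (hS.mem_subset F' hF'.1 (hBF' hβ))
  rw [hρ] at hG
  obtain ⟨D, R, hD⟩ := hS.exists_decomposition hG
  obtain ⟨hα0, hαR⟩ := hS.mem_piece_of_Xi_eq hG hD (i := 0) hαG (by exact_mod_cast hXα)
  obtain ⟨hβ1, hβR⟩ := hS.mem_piece_of_Xi_eq hG hD (i := 1) hβG (by exact_mod_cast hXβ)
  have hG0 := hD.mem_level h0
  have hG1 := hD.mem_level h1
  have hαβ : nrm T ℱ α l = nrm T ℱ β l := by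
    by_contra hne
    have : deltaOrd T ℱ α β ≤ l := Nat.sInf_le hne
    omega
  have hA0 : A ⊆ D 0 := fun x hx =>
    hS.mem_of_le hkl' hF hG0 (hAF hα) hα0 (hαmax x hx) (hAF hx)
  have hB1 : B ⊆ D 1 := fun x hx =>
    hS.mem_of_le hkl' hF' hG1 (hBF' hβ) hβ1 (hβmax x hx) (hBF' hx)
  have hmA := (hS.nrm_strictMonoOn hF).mono (Finset.coe_subset.2 hAF)
  have hmB := (hS.nrm_strictMonoOn hF').mono (Finset.coe_subset.2 hBF')
  have hcard : A.card = B.card := by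
    rw [← Finset.card_image_of_injOn hmA.injOn, himage, Finset.card_image_of_injOn hmB.injOn]
  have hnrm : ∀ a < A.card, nrm T ℱ (elt A a) l = nrm T ℱ (elt B a) l := by
    intro a ha
    have hxA := elt_mem ha
    have hyB : elt B a ∈ B := elt_mem (hcard ▸ ha)
    have hk : nrm T ℱ (elt A a) k = nrm T ℱ (elt B a) k :=
      apply_elt_eq_of_image_eq hmA hmB himage ha (hcard ▸ ha)
    obtain ⟨z, hz1, hz⟩ := hS.exists_mem_nrm_eq hG1 (hS.nrm_lt hG0 (hA0 hxA))
    obtain ⟨E, hE, hzE, hβE⟩ := hS.exists_mem_level_of_nrm_eq hkl' hG0 hG1 hF (hA0 hxA) hα0 hz1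
      hβ1 hz.symm hαβ (hαmax _ hxA) (hAF hxA) (hAF hα)
    have hzβ : z ≤ β := by
      rw [← (hS.nrm_strictMonoOn hG1).le_iff_le hz1 hβ1, hz, ← hαβ]
      exact (hS.nrm_strictMonoOn hG0).monotoneOn (hA0 hxA) hα0 (hαmax _ hxA)
    have hzF' := hS.mem_of_le le_rfl hE hF' hβE (hBF' hβ) hzβ hzE
    have hzk := hS.nrm_eq_of_le hkl' hG1 hG0 hz1 (hA0 hxA) hz
    rw [← hS.nrm_injOn hF' hzF' (hBF' hyB) (hzk.trans hk), hz]
  have hroot : ∀ a < A.card, elt A a ∈ R ∨ elt B a ∈ R → elt A a = elt B a := by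
    rintro a ha (h | h)
    · exact hS.nrm_injOn hG1 (hD.root_subset h1 h) (hB1 (elt_mem (hcard ▸ ha))) (hnrm a ha)
    · exact hS.nrm_injOn hG0 (hA0 (elt_mem ha)) (hD.root_subset h0 h) (hnrm a ha)
  have hAR : ∀ x ∈ A, x ∈ R ↔ x ∈ A ∩ B := by
    intro x hx
    rw [Finset.mem_inter]
    refine ⟨fun hxR => ⟨hx, ?_⟩,
      fun h => hD.mem_root h0 h1 Nat.zero_ne_one (hA0 h.1) (hB1 h.2)⟩
    obtain ⟨a, ha, rfl⟩ := exists_elt_eq hx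
    rw [hroot a ha (Or.inl hxR)]
    exact elt_mem (hcard ▸ ha)
  have hBR : ∀ x ∈ B, x ∈ R ↔ x ∈ A ∩ B := by
    intro x hx
    rw [Finset.mem_inter]
    refine ⟨fun hxR => ⟨?_, hx⟩,
      fun h => hD.mem_root h0 h1 Nat.zero_ne_one (hA0 h.1) (hB1 h.2)⟩
    obtain ⟨a, ha, rfl⟩ := exists_elt_eq hx
    rw [← hroot a (hcard ▸ ha) (Or.inr hxR)]
    exact elt_mem (hcard ▸ ha)
  have hinitA : InitSeg (A ∩ B) A := by
    intro x hx y hy hyx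
    rw [← hAR y hy]
    by_contra hyR
    exact hyx.not_gt (hD.root_lt h0 ((hAR x (Finset.mem_inter.1 hx).1).2 hx) (hA0 hy) hyR)
  have hinitB : InitSeg (A ∩ B) B := by
    intro x hx y hy hyx
    rw [← hBR y hy]
    by_contra hyR
    exact hyx.not_gt (hD.root_lt h1 ((hBR x (Finset.mem_inter.1 hx).2).2 hx) (hB1 hy) hyR)
  have heltA : ∀ a < A.card, (elt A a ∈ R ↔ a < (A ∩ B).card) := fun a ha => by
    rw [hAR _ (elt_mem ha), elt_mem_iff_of_initSeg Finset.inter_subset_left hinitA ha]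
  have heltB : ∀ a < B.card, (elt B a ∈ R ↔ a < (A ∩ B).card) := fun a ha => by
    rw [hBR _ (elt_mem ha), elt_mem_iff_of_initSeg Finset.inter_subset_right hinitB ha]
  have hcA : (A ∩ B).card ≤ A.card := Finset.card_le_card Finset.inter_subset_left
  have hcB : (A ∩ B).card ≤ B.card := Finset.card_le_card Finset.inter_subset_right
  have hdelta : ∀ a, (A ∩ B).card ≤ a → a < A.card →
      deltaOrd T ℱ (elt A a) (elt B a) = l + 1 := by
    intro a hra ha
    have hb : a < B.card := hcard ▸ ha
    have hxA := hA0 (elt_mem ha)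
    have hyB := hB1 (elt_mem hb)
    refine hS.deltaOrd_eq hG hG0 hG1 hxA hyB (hD.subset h0 hxA) (hD.subset h1 hyB) ?_
      (hnrm a ha)
    exact (hD.lt Nat.zero_lt_one h1 hxA (fun h => hra.not_gt ((heltA a ha).1 h)) hyB
      (fun h => hra.not_gt ((heltB a hb).1 h))).ne
  have hrho : ∀ a, (A ∩ B).card ≤ a → a < A.card → rho T ℱ (elt A a) (elt B a) = l + 1 := by
    intro a hra ha
    have hb : a < B.card := hcard ▸ ha
    exact hS.rho_eq hG hD Nat.zero_lt_one h1 (hA0 (elt_mem ha))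
      (fun h => hra.not_gt ((heltA a ha).1 h)) (hB1 (elt_mem hb))
      (fun h => hra.not_gt ((heltB a hb).1 h))
  have hfin : ∀ i < 2, i = 0 ∨ i = 1 := fun i hi => by omega
  have p0 : pairFam A B 0 = A := rfl
  have p1 : pairFam A B 1 = B := rfl
  refine ⟨⟨A ∩ B, ?_, ?_, ?_, ?_, ?_, ?_, ?_⟩, ?_⟩
  · intro i hi j hj
    rcases hfin i hi with rfl | rfl <;> rcases hfin j hj with rfl | rfl <;>
      simp only [p0, p1, hcard]
  · intro i hi j hj hij
    rcases hfin i hi with rfl | rfl <;> rcases hfin j hj with rfl | rfl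
    · exact absurd rfl hij
    · rfl
    · exact Finset.inter_comm _ _
    · exact absurd rfl hij
  · intro i hi x hx y hy
    rw [Finset.mem_sdiff] at hy
    have hxR := (hAR x (Finset.mem_inter.1 hx).1).2 hx
    rcases hfin i hi with rfl | rfl
    · exact hD.root_lt h0 hxR (hA0 hy.1) (fun h => hy.2 ((hAR y hy.1).1 h))
    · exact hD.root_lt h1 hxR (hB1 hy.1) (fun h => hy.2 ((hBR y hy.1).1 h))
  · intro i j hij hj x hx y hy
    obtain ⟨rfl, rfl⟩ : i = 0 ∧ j = 1 := by omega
    rw [Finset.mem_sdiff] at hx hy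
    exact hD.lt Nat.zero_lt_one h1 (hA0 hx.1) (fun h => hx.2 ((hAR x hx.1).1 h)) (hB1 hy.1)
      (fun h => hy.2 ((hBR y hy.1).1 h))
  · intro i hi a ha
    rcases hfin i hi with rfl | rfl
    · exact hS.Xi_eq_of_mem_root hG hD ((heltA a (by omega)).2 ha)
    · exact hS.Xi_eq_of_mem_root hG hD ((heltB a (by omega)).2 ha)
  · intro i hi a hra ha
    rcases hfin i hi with rfl | rfl
    · exact hS.Xi_eq_of_notMem_root hG hD h0 (hA0 (elt_mem ha))
        (fun h => hra.not_gt ((heltA a ha).1 h))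
    · exact hS.Xi_eq_of_notMem_root hG hD h1 (hB1 (elt_mem ha))
        (fun h => hra.not_gt ((heltB a ha).1 h))
  · intro i hi j hj hij a hra ha
    rcases hfin i hi with rfl | rfl <;> rcases hfin j hj with rfl | rfl
    · exact absurd rfl hij
    · exact hdelta a hra ha
    · rw [deltaOrd_comm]
      exact hdelta a hra (hcard ▸ ha)
    · exact absurd rfl hij
  · intro i hi j hj hij a hra ha
    rcases hfin i hi with rfl | rfl <;> rcases hfin j hj with rfl | rfl
    · exact absurd rfl hij
    · exact hrho a hra ha
    · rw [rho_comm]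
      rw [p0, p1, Finset.inter_comm] at hra
      exact hrho a hra (hcard ▸ ha)
    · exact absurd rfl hij

lemma subset_of_image_nrm_eq (hS : IsConstructionScheme T ℱ) {k : ℕ} {A B F F' : Finset Ordinal}
    (hF : F ∈ schemeLevel T ℱ k) (hF' : F' ∈ schemeLevel T ℱ k) (hAF : A ⊆ F) (hBF' : B ⊆ F')
    (himage : A.image (fun x => nrm T ℱ x k) = B.image (fun x => nrm T ℱ x k))
    {α : Ordinal} (hαA : α ∈ A) (hαB : α ∈ B) (hαmax : ∀ x ∈ A, x ≤ α) : A ⊆ B := by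
  intro x hx
  have hxF' := hS.mem_of_le le_rfl hF hF' (hAF hαA) (hBF' hαB) (hαmax x hx) (hAF hx)
  have : nrm T ℱ x k ∈ B.image (fun x => nrm T ℱ x k) :=
    himage ▸ Finset.mem_image_of_mem _ hx
  obtain ⟨y, hy, hyx⟩ := Finset.mem_image.1 this
  rw [← hS.nrm_injOn hF' (hBF' hy) hxF' hyx]
  exact hy

lemma exists_uncountable_same_position (hS : IsConstructionScheme T ℱ)
    {𝒮 : Set (Finset Ordinal)} (h𝒮 : ∀ A ∈ 𝒮, A.Nonempty ∧ ↑A ⊆ Set.Iio omegaOne)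
    (hunc : ¬ 𝒮.Countable) :
    ∃ (k : ℕ) (P : Finset ℕ), ¬ {A ∈ 𝒮 | ∃ F ∈ schemeLevel T ℱ k, A ⊆ F ∧
      A.image (fun x => nrm T ℱ x k) = P}.Countable := by
  by_contra! hcount
  refine hunc (Set.Countable.mono (s₂ := ⋃ (k : ℕ) (P : Finset ℕ),
    {A ∈ 𝒮 | ∃ F ∈ schemeLevel T ℱ k, A ⊆ F ∧ A.image (fun x => nrm T ℱ x k) = P}) ?_
    (Set.countable_iUnion fun k => Set.countable_iUnion fun P => hcount k P))
  intro A hA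
  obtain ⟨F, hF, hAF⟩ := hS.cofinal A (h𝒮 A hA).2
  obtain ⟨k, hk⟩ := hS.card_eq F hF
  simp only [Set.mem_iUnion]
  exact ⟨k, _, hA, F, ⟨hF, hk⟩, hAF, rfl⟩

lemma twoCapturing_of_pairs (hS : IsConstructionScheme T ℱ)
    (h : ∀ S : Set Ordinal, S ⊆ Set.Iio omegaOne → ¬ S.Countable →
      {l : ℕ | ∃ α ∈ S, ∃ β ∈ S, α ≠ β ∧ CapturedPair T ℱ α β l}.Infinite) :
    TwoCapturing T ℱ := by
  intro 𝒮 h𝒮 hunc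
  obtain ⟨k, P, hP⟩ := hS.exists_uncountable_same_position h𝒮 hunc
  set 𝒯 := {A ∈ 𝒮 | ∃ F ∈ schemeLevel T ℱ k, A ⊆ F ∧
    A.image (fun x => nrm T ℱ x k) = P}
  have htop : ∀ A ∈ 𝒯, A.sup id ∈ A := fun A hA => by
    obtain ⟨x, hx, heq⟩ := Finset.exists_mem_eq_sup A (h𝒮 A hA.1).1 id
    rw [heq]
    exact hx
  have hmax : ∀ A : Finset Ordinal, ∀ x ∈ A, x ≤ A.sup id :=
    fun A x hx => Finset.le_sup (f := id) hx
  have hinj : Set.InjOn (fun A : Finset Ordinal => A.sup id) 𝒯 := by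
    intro A hA B hB hAB
    obtain ⟨-, F, hF, hAF, hAP⟩ := id hA
    obtain ⟨-, F', hF', hBF', hBP⟩ := id hB
    have hAB' : A.sup id = B.sup id := hAB
    refine Finset.Subset.antisymm ?_ ?_
    · exact hS.subset_of_image_nrm_eq hF hF' hAF hBF' (hAP.trans hBP.symm) (htop A hA)
        (hAB' ▸ htop B hB) (hmax A)
    · exact hS.subset_of_image_nrm_eq hF' hF hBF' hAF (hBP.trans hAP.symm) (htop B hB)
        (hAB' ▸ htop A hA) (hmax B)
  have hinf := h ((fun A : Finset Ordinal => A.sup id) '' 𝒯) (by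
    rintro _ ⟨A, hA, rfl⟩
    exact (h𝒮 A hA.1).2 (htop A hA))
    (fun hc => hP (Set.countable_of_injective_of_countable_image hinj hc))
  refine (hinf.sdiff (Set.finite_Iic k)).mono ?_
  rintro l ⟨⟨_, ⟨A, hA, rfl⟩, _, ⟨B, hB, rfl⟩, hne, hcap⟩, hl⟩
  obtain ⟨hA𝒮, F, hF, hAF, hAP⟩ := id hA
  obtain ⟨hB𝒮, F', hF', hBF', hBP⟩ := id hB
  refine ⟨A, hA𝒮, B, hB𝒮, fun hAB => hne (by rw [hAB]), ?_⟩
  exact hS.capturedFam_of_capturedPair (not_le.1 hl) hF hF' hAF hBF' (hAP.trans hBP.symm)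
    (htop A hA) (hmax A) (htop B hB) (hmax B) hcap

end IsConstructionScheme

lemma capturedPair_of_capturedFam_singleton {α β : Ordinal} (hne : α ≠ β) {l : ℕ}
    (h : CapturedFam T ℱ 2 (pairFam {α} {β}) l) : CapturedPair T ℱ α β l := by
  obtain ⟨⟨R, -, hR, -, hlt, -, hXi, hΔ⟩, hρ⟩ := h
  have p0 : pairFam {α} {β} 0 = {α} := rfl
  have p1 : pairFam {α} {β} 1 = {β} := rfl
  have hinter : ({α} : Finset Ordinal) ∩ {β} = ∅ := by
    rw [← Finset.disjoint_iff_inter_eq_empty, Finset.disjoint_singleton]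
    exact hne
  obtain rfl : R = ∅ := by
    rw [← hR 0 (by omega) 1 (by omega) (by omega), p0, p1, hinter]
  have hX0 := hXi 0 (by omega) 0 (by simp) (by simp [p0])
  have hX1 := hXi 1 (by omega) 0 (by simp) (by simp [p1])
  have hΔ' := hΔ 0 (by omega) 1 (by omega) (by omega) 0 (by simp) (by simp [p0])
  have hρ' := hρ 0 (by omega) 1 (by omega) (by omega) 0 (by simp [p0, p1, hinter]) (by simp [p0])
  simp only [p0, p1, elt_singleton] at hX0 hX1 hΔ' hρ'
  exact ⟨hlt 0 1 (by omega) (by omega) α (by simp [p0]) β (by simp [p1]),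
    by exact_mod_cast hX0, by exact_mod_cast hX1, hΔ', hρ'⟩

lemma TwoCapturing.pairs (h : TwoCapturing T ℱ) {S : Set Ordinal} (hS : S ⊆ Set.Iio omegaOne)
    (hunc : ¬ S.Countable) :
    {l : ℕ | ∃ α ∈ S, ∃ β ∈ S, α ≠ β ∧ CapturedPair T ℱ α β l}.Infinite := by
  have hsing : ∀ A ∈ (fun x : Ordinal => ({x} : Finset Ordinal)) '' S,
      A.Nonempty ∧ ↑A ⊆ Set.Iio omegaOne := by
    rintro _ ⟨x, hx, rfl⟩
    exact ⟨Finset.singleton_nonempty x, by simpa using hS hx⟩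
  refine (h _ hsing fun hc => hunc (Set.countable_of_injective_of_countable_image
    Finset.singleton_injective.injOn hc)).mono ?_
  rintro l ⟨_, ⟨α, hα, rfl⟩, _, ⟨β, hβ, rfl⟩, hne, hcap⟩
  have hαβ : α ≠ β := fun heq => hne (by rw [heq])
  exact ⟨α, hα, β, hβ, hαβ, capturedPair_of_capturedFam_singleton hαβ hcap⟩

end Scheme

/-- A scheme `ℱ` is 2-capturing iff for every uncountable `S ⊆ ω₁` there are infinitely many
levels `l` at which some pair of distinct elements of `S` is captured (i.e. `⟨{α},{β}⟩` is
captured at level `l`). -/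
theorem stmt17 (T : SchemeType) (ℱ : Set (Finset Ordinal))
    (hS : IsConstructionScheme T ℱ) :
    TwoCapturing T ℱ ↔
      ∀ S : Set Ordinal, S ⊆ Set.Iio omegaOne → ¬ S.Countable →
        {l : ℕ | ∃ α ∈ S, ∃ β ∈ S, α ≠ β ∧ CapturedPair T ℱ α β l}.Infinite :=
  ⟨fun h _ hsub hunc => h.pairs hsub hunc, fun h => hS.twoCapturing_of_pairs h⟩

end
end

section
/- Let E ⊆ ℝ be an entangled set and let ⟨e_α⟩_{α<ω₁} be an injective enumeration of uncountably many pairwise disjoint 2-element subsets of E. Then the partial order ℙ, consisting of all finite A ⊆ ω₁ such that type(e_α, e_β) is constant for all distinct α, β ∈ A, ordered by reverse inclusion, has no uncountable antichain (is ccc). -/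
noncomputable section

/-- Conditions of the forcing `ℙ`: finite `A ⊆ ω₁` such that `type(e_α, e_β)` is constant for
all distinct `α, β ∈ A`; `ℙ` is ordered by reverse inclusion. -/
def Pcond (e : Ordinal → Fin 2 → ℝ) (A : Finset Ordinal) : Prop :=
  ↑A ⊆ Set.Iio omegaOne ∧
  ∀ α ∈ A, ∀ β ∈ A, α ≠ β → ((∀ i, e α i < e β i) ∨ (∀ i, e β i < e α i))

/-- An uncountable set has an uncountable fibre under any map to a countable type. -/
theorem exists_uncountable_fiber {α β : Type*} [Countable β] {s : Set α} (hs : ¬ s.Countable)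
    (c : α → β) : ∃ b, ¬ {a ∈ s | c a = b}.Countable := by
  by_contra! h
  refine hs ((Set.countable_iUnion h).mono fun a ha => ?_)
  exact Set.mem_iUnion.2 ⟨c a, ha, rfl⟩

/-- An uncountable family of nonempty finite sets in which every point lies in only countably many
members has an uncountable pairwise disjoint subfamily. -/
theorem exists_uncountable_pairwiseDisjoint {ι : Type*} {𝒜 : Set (Finset ι)}
    (hne : ∀ A ∈ 𝒜, A.Nonempty) (hunc : ¬ 𝒜.Countable)
    (hpt : ∀ x, {A ∈ 𝒜 | x ∈ A}.Countable) :
    ∃ ℬ ⊆ 𝒜, ¬ ℬ.Countable ∧ ℬ.Pairwise Disjoint := by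
  obtain ⟨ℬ, hℬ⟩ := zorn_subset {ℬ : Set (Finset ι) | ℬ ⊆ 𝒜 ∧ ℬ.Pairwise Disjoint}
    fun c hc hchain => ⟨⋃₀ c, ⟨Set.sUnion_subset fun s hs => (hc hs).1,
      (Set.pairwise_sUnion hchain.directedOn).2 fun s hs => (hc hs).2⟩,
      fun s hs => Set.subset_sUnion_of_mem hs⟩
  refine ⟨ℬ, hℬ.prop.1, fun hcount => hunc ?_, hℬ.prop.2⟩
  refine (hcount.biUnion fun B _ => B.countable_toSet.biUnion fun x _ => hpt x).mono fun A hA => ?_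
  suffices h : ∃ B ∈ ℬ, ∃ x ∈ B, x ∈ A by
    obtain ⟨B, hB, x, hx, hxA⟩ := h
    exact Set.mem_biUnion hB (Set.mem_biUnion hx ⟨hA, hxA⟩)
  by_contra! h
  have hdisj : ∀ B ∈ ℬ, Disjoint A B := fun B hB =>
    Finset.disjoint_right.2 fun x hx => h B hB x hx
  have hmem : A ∈ ℬ := hℬ.le_of_ge (y := insert A ℬ)
    ⟨Set.insert_subset hA hℬ.prop.1,
      hℬ.prop.2.insert fun B hB _ => ⟨hdisj B hB, (hdisj B hB).symm⟩⟩
    (Set.subset_insert A ℬ) (Set.mem_insert A ℬ)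
  obtain ⟨x, hx⟩ := hne A hA
  exact h A hmem x hx hx

/-- The rational `q i j` separates the entries `f i < f j` whenever `i < j`. -/
def SeparatedBy {m : ℕ} (q : Fin m → Fin m → ℚ) (f : Fin m → ℝ) : Prop :=
  ∀ i j, i < j → f i < q i j ∧ (q i j : ℝ) < f j

theorem exists_separatedBy {m : ℕ} {f : Fin m → ℝ} (hf : StrictMono f) :
    ∃ q, SeparatedBy q f := by
  have h : ∀ i j, ∃ q : ℚ, i < j → f i < q ∧ (q : ℝ) < f j := fun i j => by
    by_cases hij : i < j
    · obtain ⟨q, hq⟩ := exists_rat_btwn (hf hij)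
      exact ⟨q, fun _ => hq⟩
    · exact ⟨0, fun h => absurd h hij⟩
  choose q hq using h
  exact ⟨q, hq⟩

theorem SeparatedBy.lt {m : ℕ} {q : Fin m → Fin m → ℚ} {f g : Fin m → ℝ}
    (hf : SeparatedBy q f) (hg : SeparatedBy q g) {i j : Fin m} (hij : i < j) : f i < g j :=
  (hf i j hij).1.trans (hg i j hij).2

/-- The type of `e α` against `e β` is constant. -/
def ConstType {ι : Type*} (e : ι → Fin 2 → ℝ) (α β : ι) : Prop :=
  (∀ i, e α i < e β i) ∨ (∀ i, e β i < e α i)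

theorem ConstType.symm {ι : Type*} {e : ι → Fin 2 → ℝ} {α β : ι} (h : ConstType e α β) :
    ConstType e β α := Or.symm h

/-- The pairs of positions, in the enumeration `f`, taken by the pairs `e α` with `α ∈ D`. -/
def pairPattern {ι : Type*} (e : ι → Fin 2 → ℝ) {m : ℕ} (f : Fin m → ℝ) (D : Finset ι) :
    Set (Fin m × Fin m) :=
  {p | ∃ α ∈ D, e α 0 = f p.1 ∧ e α 1 = f p.2}

/-- If two finite sets of pairs have the same pattern and the same separation, then a pair from the
one and a pair from the other with a smaller first position are of constant type. -/
theorem constType_of_lt {ι : Type*} {e : ι → Fin 2 → ℝ} {m : ℕ} {q : Fin m → Fin m → ℚ}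
    {f g : Fin m → ℝ} {D D' : Finset ι} (hf : StrictMono f)
    (hfq : SeparatedBy q f) (hgq : SeparatedBy q g)
    (hD : ∀ α ∈ D, ∀ β ∈ D, α ≠ β → ConstType e α β)
    (hpat : pairPattern e f D = pairPattern e g D')
    {α β : ι} (hα : α ∈ D) (hβ : β ∈ D') {i j i' j' : Fin m}
    (hi : e α 0 = f i) (hj : e α 1 = f j) (hi' : e β 0 = g i') (hj' : e β 1 = g j')
    (hlt : i < i') : ∀ k, e α k < e β k := by
  have hmem : (i', j') ∈ pairPattern e f D := hpat ▸ ⟨β, hβ, hi', hj'⟩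
  obtain ⟨γ, hγ, h0, h1⟩ := hmem
  have h0lt : e α 0 < e γ 0 := by rw [hi, h0]; exact hf hlt
  have hne : α ≠ γ := by rintro rfl; exact lt_irrefl _ h0lt
  have h1lt : e α 1 < e γ 1 := by
    rcases hD α hα γ hγ hne with h | h
    · exact h 1
    · exact absurd (h 0) h0lt.not_gt
  rw [hj, h1, hf.lt_iff_lt] at h1lt
  rw [Fin.forall_fin_two, hi, hj, hi', hj']
  exact ⟨hfq.lt hgq hlt, hfq.lt hgq h1lt⟩

/-- In an uncountable pairwise disjoint family of finite sets of constant type, some two distinct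
members have constant type against each other. -/
theorem exists_constType_of_pairwiseDisjoint {ι : Type*} {E : Set ℝ}
    (hE : ∀ n : ℕ, 1 ≤ n → IsNEntangled E n) {e : ι → Fin 2 → ℝ} {I : Set ι}
    (hmem : ∀ α ∈ I, ∀ i, e α i ∈ E)
    (hdisj : ∀ α ∈ I, ∀ β ∈ I, α ≠ β → ∀ i j, e α i ≠ e β j)
    {𝒟 : Set (Finset ι)} (hI : ∀ D ∈ 𝒟, ∀ α ∈ D, α ∈ I)
    (hconst : ∀ D ∈ 𝒟, ∀ α ∈ D, ∀ β ∈ D, α ≠ β → ConstType e α β)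
    (hne : ∀ D ∈ 𝒟, D.Nonempty) (hpd : 𝒟.Pairwise Disjoint) (hunc : ¬ 𝒟.Countable) :
    ∃ D ∈ 𝒟, ∃ D' ∈ 𝒟, D ≠ D' ∧ ∀ α ∈ D, ∀ β ∈ D', α ≠ β → ConstType e α β := by
  classical
  let S : Finset ι → Finset ℝ := fun D => (D ×ˢ Finset.univ).image fun p => e p.1 p.2
  have hS : ∀ D x, x ∈ S D ↔ ∃ α ∈ D, ∃ i, e α i = x := fun D x => by
    simp only [S, Finset.mem_image, Finset.mem_product, Finset.mem_univ, and_true, Prod.exists]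
    exact ⟨fun ⟨α, i, h, h'⟩ => ⟨α, h, i, h'⟩, fun ⟨α, h, i, h'⟩ => ⟨α, i, h, h'⟩⟩
  obtain ⟨m, hm⟩ := exists_uncountable_fiber hunc fun D => (S D).card
  have hex : ∀ D : Finset ι, ∃ f : Fin m → ℝ, ∃ q, (S D).card = m →
      StrictMono f ∧ Set.range f = S D ∧ SeparatedBy q f := fun D => by
    by_cases h : (S D).card = m
    · have hf := ((S D).orderEmbOfFin h).strictMono
      obtain ⟨q, hq⟩ := exists_separatedBy hf
      exact ⟨_, q, fun _ => ⟨hf, Finset.range_orderEmbOfFin _ h, hq⟩⟩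
    · exact ⟨0, 0, fun h' => absurd h' h⟩
  choose f q hfq using hex
  obtain ⟨⟨q₀, P⟩, hunc'⟩ :=
    exists_uncountable_fiber hm fun D => (q D, pairPattern e (f D) D)
  set 𝒟' := {D ∈ {D ∈ 𝒟 | (S D).card = m} | (q D, pairPattern e (f D) D) = (q₀, P)}
  have hsub : ∀ D ∈ 𝒟', D ∈ 𝒟 := fun D hD => hD.1.1
  have hmono : ∀ D ∈ 𝒟', StrictMono (f D) := fun D hD => (hfq D hD.1.2).1
  have hsep : ∀ D ∈ 𝒟', SeparatedBy q₀ (f D) := fun D hD => by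
    have hq : q D = q₀ := (Prod.ext_iff.1 hD.2).1
    exact hq ▸ (hfq D hD.1.2).2.2
  have hpat : ∀ D ∈ 𝒟', pairPattern e (f D) D = P := fun D hD => (Prod.ext_iff.1 hD.2).2
  have hfe : ∀ D ∈ 𝒟', ∀ i, ∃ α ∈ D, ∃ k, e α k = f D i := fun D hD i =>
    (hS D _).1 (by rw [← Finset.mem_coe, ← (hfq D hD.1.2).2.1]; exact Set.mem_range_self i)
  have hef : ∀ D ∈ 𝒟', ∀ α ∈ D, ∀ k, ∃ i, e α k = f D i := fun D hD α hα k => by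
    have : e α k ∈ Set.range (f D) := by
      rw [(hfq D hD.1.2).2.1, Finset.mem_coe, hS]
      exact ⟨α, hα, k, rfl⟩
    obtain ⟨i, hi⟩ := this
    exact ⟨i, hi.symm⟩
  have hfne : ∀ D ∈ 𝒟', ∀ D' ∈ 𝒟', D ≠ D' → ∀ i j, f D i ≠ f D' j := by
    intro D hD D' hD' hDD' i j
    obtain ⟨α, hα, k, hk⟩ := hfe D hD i
    obtain ⟨β, hβ, l, hl⟩ := hfe D' hD' j
    rw [← hk, ← hl]
    have hd := hpd (hsub D hD) (hsub D' hD') hDD'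
    exact hdisj α (hI D (hsub D hD) α hα) β (hI D' (hsub D' hD') β hβ)
      (fun h => Finset.disjoint_left.1 hd hα (h ▸ hβ)) k l
  have hm1 : 1 ≤ m := by
    obtain ⟨D, hD⟩ : 𝒟'.Nonempty := by
      rw [Set.nonempty_iff_ne_empty]
      intro h
      exact hunc' (h ▸ Set.countable_empty)
    obtain ⟨α, hα⟩ := hne D (hsub D hD)
    obtain ⟨i, -⟩ := hef D hD α hα 0
    exact i.pos
  have hinj : Set.InjOn f 𝒟' := fun D hD D' hD' h => by
    by_contra hDD'
    exact hfne D hD D' hD' hDD' ⟨0, hm1⟩ ⟨0, hm1⟩ (congrFun h _)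
  obtain ⟨_, ⟨D, hD, rfl⟩, _, ⟨D', hD', rfl⟩, hab, hτ⟩ := (hE m hm1).2 (fun _ => 0) (f '' 𝒟')
    (by
      rintro _ ⟨D, hD, rfl⟩
      refine ⟨hmono D hD, fun i => ?_⟩
      obtain ⟨α, hα, k, hk⟩ := hfe D hD i
      exact hk ▸ hmem α (hI D (hsub D hD) α hα) k)
    (by
      rintro _ ⟨D, hD, rfl⟩ _ ⟨D', hD', rfl⟩ h
      exact hfne D hD D' hD' fun h' => h (congrArg f h'))
    (fun h => hunc' (Set.countable_of_injective_of_countable_image hinj h))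
  refine ⟨D, hsub D hD, D', hsub D' hD', fun h => hab (congrArg f h), fun α hα β hβ _ => ?_⟩
  obtain ⟨i, hi⟩ := hef D hD α hα 0
  obtain ⟨j, hj⟩ := hef D hD α hα 1
  obtain ⟨i', hi'⟩ := hef D' hD' β hβ 0
  obtain ⟨j', hj'⟩ := hef D' hD' β hβ 1
  have hpp : pairPattern e (f D) D = pairPattern e (f D') D' := (hpat D hD).trans (hpat D' hD').symm
  rcases lt_trichotomy i i' with h | rfl | h
  · exact Or.inl (constType_of_lt (hmono D hD) (hsep D hD) (hsep D' hD')
      (hconst D (hsub D hD)) hpp hα hβ hi hj hi' hj' h)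
  · obtain ⟨γ, hγ, h0, h1⟩ : (i, j') ∈ pairPattern e (f D) D := hpp ▸ ⟨β, hβ, hi', hj'⟩
    have hγα : γ = α := by
      by_contra hne'
      exact hdisj γ (hI D (hsub D hD) γ hγ) α (hI D (hsub D hD) α hα) hne' 0 0 (h0.trans hi.symm)
    subst hγα
    left
    rw [Fin.forall_fin_two, hi, hi', h1, hj']
    exact ⟨(hτ i).2 rfl, (hτ j').2 rfl⟩
  · exact Or.inr (constType_of_lt (hmono D' hD') (hsep D' hD') (hsep D hD)
      (hconst D' (hsub D' hD')) hpp.symm hβ hα hi' hj' hi hj h)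

/-- In an uncountable family of finite sets of constant type, all of the same size, some two
distinct members have constant type against each other. -/
theorem exists_constType_of_card_eq {ι : Type*} {E : Set ℝ}
    (hE : ∀ n : ℕ, 1 ≤ n → IsNEntangled E n) {e : ι → Fin 2 → ℝ} {I : Set ι}
    (hmem : ∀ α ∈ I, ∀ i, e α i ∈ E)
    (hdisj : ∀ α ∈ I, ∀ β ∈ I, α ≠ β → ∀ i j, e α i ≠ e β j) (n : ℕ) :
    ∀ 𝒜 : Set (Finset ι), (∀ A ∈ 𝒜, A.card = n) → (∀ A ∈ 𝒜, ∀ α ∈ A, α ∈ I) →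
      (∀ A ∈ 𝒜, ∀ α ∈ A, ∀ β ∈ A, α ≠ β → ConstType e α β) → ¬ 𝒜.Countable →
      ∃ A ∈ 𝒜, ∃ B ∈ 𝒜, A ≠ B ∧ ∀ α ∈ A, ∀ β ∈ B, α ≠ β → ConstType e α β := by
  classical
  induction n with
  | zero =>
    intro 𝒜 hcard _ _ hunc
    refine absurd ((Set.countable_singleton ∅).mono fun A hA => ?_) hunc
    exact Finset.card_eq_zero.1 (hcard A hA)
  | succ n ih =>
    intro 𝒜 hcard hI hconst hunc
    by_cases hpt : ∀ x, {A ∈ 𝒜 | x ∈ A}.Countable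
    · have hne : ∀ A ∈ 𝒜, A.Nonempty := fun A hA =>
        Finset.card_pos.1 (hcard A hA ▸ n.succ_pos)
      obtain ⟨ℬ, hℬ, hℬunc, hpd⟩ := exists_uncountable_pairwiseDisjoint hne hunc hpt
      obtain ⟨A, hA, B, hB, h⟩ := exists_constType_of_pairwiseDisjoint hE hmem hdisj
        (fun D hD => hI D (hℬ hD)) (fun D hD => hconst D (hℬ hD)) (fun D hD => hne D (hℬ hD))
        hpd hℬunc
      exact ⟨A, hℬ hA, B, hℬ hB, h⟩
    · push Not at hpt
      obtain ⟨γ, hγ⟩ := hpt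
      have hinj : Set.InjOn (fun A : Finset ι => A.erase γ) {A ∈ 𝒜 | γ ∈ A} :=
        fun A hA B hB h => by
          rw [← Finset.insert_erase hA.2, ← Finset.insert_erase hB.2]
          exact congrArg (insert γ) h
      obtain ⟨_, ⟨A, hA, rfl⟩, _, ⟨B, hB, rfl⟩, hAB, h⟩ :=
        ih ((fun A : Finset ι => A.erase γ) '' {A ∈ 𝒜 | γ ∈ A})
        (by
          rintro _ ⟨A, hA, rfl⟩
          simp [Finset.card_erase_of_mem hA.2, hcard A hA.1])
        (by
          rintro _ ⟨A, hA, rfl⟩ α hα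
          exact hI A hA.1 α (Finset.mem_of_mem_erase hα))
        (by
          rintro _ ⟨A, hA, rfl⟩ α hα β hβ
          exact hconst A hA.1 α (Finset.mem_of_mem_erase hα) β (Finset.mem_of_mem_erase hβ))
        (fun h => hγ (Set.countable_of_injective_of_countable_image hinj h))
      refine ⟨A, hA.1, B, hB.1, fun h' => hAB (by rw [h']), fun α hα β hβ hne => ?_⟩
      by_cases hαγ : α = γ
      · exact hconst B hB.1 α (hαγ ▸ hB.2) β hβ hne
      by_cases hβγ : β = γ
      · exact hconst A hA.1 α hα β (hβγ ▸ hA.2) hne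
      exact h α (Finset.mem_erase.2 ⟨hαγ, hα⟩) β (Finset.mem_erase.2 ⟨hβγ, hβ⟩) hne

/-- If `E ⊆ ℝ` is entangled and `⟨e_α⟩_{α<ω₁}` injectively enumerates uncountably many pairwise
disjoint 2-element subsets of `E`, then the forcing `ℙ` of finite sets of indices on which the
types are constant has no uncountable antichain (is ccc). -/
theorem stmt18 (E : Set ℝ) (hE : ∀ n : ℕ, 1 ≤ n → IsNEntangled E n)
    (e : Ordinal → Fin 2 → ℝ)
    (hmono : ∀ α < omegaOne, StrictMono (e α) ∧ ∀ i, e α i ∈ E)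
    (hdisj : ∀ α < omegaOne, ∀ β < omegaOne, α ≠ β → ∀ i j, e α i ≠ e β j) :
    ∀ 𝒜 : Set (Finset Ordinal),
      (∀ A ∈ 𝒜, Pcond e A) →
      (𝒜.Pairwise fun A B =>
        ¬ ∃ C : Finset Ordinal, Pcond e C ∧ A ⊆ C ∧ B ⊆ C) →
      𝒜.Countable := by
  classical
  intro 𝒜 hP hanti
  by_contra hunc
  obtain ⟨n, hn⟩ := exists_uncountable_fiber hunc Finset.card
  obtain ⟨A, hA, B, hB, hAB, h⟩ := exists_constType_of_card_eq hE (I := Set.Iio omegaOne)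
    (fun α hα => (hmono α hα).2) hdisj n {A ∈ 𝒜 | A.card = n} (fun A hA => hA.2)
    (fun A hA α hα => (hP A hA.1).1 hα) (fun A hA => (hP A hA.1).2) hn
  refine hanti hA.1 hB.1 hAB ⟨A ∪ B, ⟨?_, fun α hα β hβ hne => ?_⟩,
    Finset.subset_union_left, Finset.subset_union_right⟩
  · rw [Finset.coe_union]
    exact Set.union_subset (hP A hA.1).1 (hP B hB.1).1
  · rcases Finset.mem_union.1 hα with hα | hα <;> rcases Finset.mem_union.1 hβ with hβ | hβ
    · exact (hP A hA.1).2 α hα β hβ hne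
    · exact h α hα β hβ hne
    · exact (h β hβ α hα hne.symm).symm
    · exact (hP B hB.1).2 α hα β hβ hne

end
end

section
/- Consider ℤ^ω ordered lexicographically: f <_lex g iff f(d) < g(d) where d is the least coordinate at which f and g differ. Then the countable set of eventually-zero integer sequences is order-dense: for all f <_lex g there is an eventually-zero h with f <_lex h <_lex g. Consequently there exists a strictly increasing (order-embedding) map from (ℤ^ω, <_lex) into ℝ. -/
/-- A linear order with a countable set meeting every nonempty open interval has a strictly
monotone map into `ℝ`. -/
theorem exists_strictMono_real_of_countable_dense {α : Type*} [LinearOrder α] {D : Set α}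
    (hD : D.Countable) (hdense : ∀ x y : α, x < y → ∃ d ∈ D, x < d ∧ d < y) :
    ∃ F : α → ℝ, StrictMono F := by
  have := hD.toEncodable
  obtain ⟨w, hw, c, hc, -⟩ := posSumOfEncodable one_pos D
  let S : α → Set D := fun x => {d | d.1 < x}
  refine ⟨fun x => ∑' d, (S x).indicator w d, fun x y hxy => ?_⟩
  obtain ⟨d, hd, hxd, hdy⟩ := hdense x y hxy
  refine Summable.tsum_lt_tsum (i := ⟨d, hd⟩) (fun e => ?_) ?_
    (hc.summable.indicator _) (hc.summable.indicator _)
  · exact Set.indicator_le_indicator_of_subset (fun e he => lt_trans he hxy)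
      (fun e => (hw e).le) e
  · have hx : (⟨d, hd⟩ : D) ∉ S x := fun h => lt_asymm hxd h
    have hy : (⟨d, hd⟩ : D) ∈ S y := hdy
    rw [Set.indicator_of_notMem hx, Set.indicator_of_mem hy]
    exact hw _

theorem countable_setOf_finite_support :
    {h : Lex (ℕ → ℤ) | {k : ℕ | ofLex h k ≠ 0}.Finite}.Countable := by
  refine (Set.countable_range fun f : ℕ →₀ ℤ => toLex (f : ℕ → ℤ)).mono fun h hh => ?_
  exact ⟨Finsupp.ofSupportFinite (ofLex h) hh, rfl⟩

theorem exists_finite_support_between {f g : Lex (ℕ → ℤ)} (hfg : f < g) :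
    ∃ h : Lex (ℕ → ℤ), {k : ℕ | ofLex h k ≠ 0}.Finite ∧ f < h ∧ h < g := by
  obtain ⟨d, heq, hlt⟩ := hfg
  refine ⟨toLex fun k => if k ≤ d then ofLex f k else if k = d + 1 then ofLex f k + 1 else 0,
    (Set.finite_Iic (d + 1)).subset fun k hk => ?_, ⟨d + 1, fun j hj => ?_, ?_⟩,
    ⟨d, fun j hj => ?_, ?_⟩⟩
  · by_contra hkd
    simp only [Set.mem_Iic, not_le] at hkd
    exact hk (by simp [show ¬ k ≤ d by omega, show k ≠ d + 1 by omega])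
  · simp [Nat.lt_succ_iff.mp hj]
  · simp
  · simpa [hj.le] using heq j hj
  · simpa using hlt

/-- In `ℤ^ω` with the lexicographic order, the eventually-zero sequences form an order-dense
(countable) subset; consequently there is a strictly increasing map (order-embedding) from
`(ℤ^ω, <_lex)` into `ℝ`. -/
theorem stmt19 :
    {h : Lex (ℕ → ℤ) | {k : ℕ | ofLex h k ≠ 0}.Finite}.Countable ∧
    (∀ f g : Lex (ℕ → ℤ), f < g →
      ∃ h : Lex (ℕ → ℤ), {k : ℕ | ofLex h k ≠ 0}.Finite ∧ f < h ∧ h < g) ∧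
    ∃ F : Lex (ℕ → ℤ) → ℝ, StrictMono F := by
  exact ⟨countable_setOf_finite_support, fun f g => exists_finite_support_between,
    exists_strictMono_real_of_countable_dense countable_setOf_finite_support
      fun f g => exists_finite_support_between⟩
end
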